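/- Let Y be GEV(τ₀, μ₀, ξ₀) with ξ₀ ≠ 0, w = 1 + ξ₀(Y - μ₀)/τ₀, let α satisfy α·ξ₀ + 1 > 0, and let b be a positive integer. Then E[w^{-α}·|log w|^b] < |ξ₀|^b·Γ^{(b)}(αξ₀+1) + 3|ξ₀|^b·Γ(b+1)/(αξ₀+1)^{b+1}. -/

import Mathlib

open MeasureTheory

/-- CDF of the generalized extreme value distribution with parameters `(τ₀, μ₀, ξ₀)`, `ξ₀ ≠ 0`. -/
noncomputable def gevCDF (τ₀ μ₀ ξ₀ : ℝ) (y : ℝ) : ℝ :=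
  if 0 < 1 + ξ₀ * (y - μ₀) / τ₀ then
    Real.exp (-(1 + ξ₀ * (y - μ₀) / τ₀) ^ (-1 / ξ₀))
  else if 0 < ξ₀ then 0 else 1


noncomputable def gevNu : Measure ℝ :=
  (volume.restrict (Set.Ioi (0:ℝ))).withDensity (fun s => ENNReal.ofReal (Real.exp (-s)))

lemma gevNu_integral (g : ℝ → ℝ) :
    ∫ s, g s ∂gevNu = ∫ s in Set.Ioi (0:ℝ), Real.exp (-s) * g s := by
  unfold gevNu
  rw [integral_withDensity_eq_integral_toReal_smul (by fun_prop) (by simp)]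
  refine integral_congr_ae (Filter.Eventually.of_forall fun s => ?_)
  simp [ENNReal.toReal_ofReal (Real.exp_pos _).le]

lemma gevNu_integrable (g : ℝ → ℝ) :
    Integrable g gevNu ↔ IntegrableOn (fun s => Real.exp (-s) * g s) (Set.Ioi (0:ℝ)) := by
  unfold gevNu
  rw [integrable_withDensity_iff_integrable_smul' (by fun_prop) (by simp)]
  unfold IntegrableOn
  refine integrable_congr (Filter.Eventually.of_forall fun s => ?_)
  simp [ENNReal.toReal_ofReal (Real.exp_pos _).le]

lemma gevNu_ae : ∀ᵐ s ∂gevNu, 0 < s := by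
  unfold gevNu
  exact (withDensity_absolutelyContinuous _ _).ae_le (ae_restrict_mem measurableSet_Ioi)

lemma gevNu_Ici (c : ℝ) (hc : 0 ≤ c) : gevNu (Set.Ici c) = ENNReal.ofReal (Real.exp (-c)) := by
  unfold gevNu
  rw [withDensity_apply _ measurableSet_Ici, Measure.restrict_restrict measurableSet_Ici,
    ← integral_exp_neg_Ioi c, ofReal_integral_eq_lintegral_ofReal (integrableOn_exp_neg_Ioi c)
      (Filter.Eventually.of_forall fun s => (Real.exp_pos _).le)]
  refine setLIntegral_congr ?_
  refine Filter.EventuallyEq.trans ?_ (Ioi_ae_eq_Ici (a := c)).symm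
  have : (Set.Ici c ∩ Set.Ioi 0 : Set ℝ) =ᵐ[volume] (Set.Ici c ∩ Set.Ici 0 : Set ℝ) :=
    (Filter.EventuallyEq.refl _ _).inter Ioi_ae_eq_Ici
  refine this.trans ?_
  rw [Set.inter_eq_left.2 (Set.Ici_subset_Ici.2 hc)]
  exact Filter.EventuallyEq.refl _ _

lemma gevNu_univ : gevNu Set.univ = 1 := by
  have h := gevNu_Ici 0 le_rfl
  rw [neg_zero, Real.exp_zero, ENNReal.ofReal_one] at h
  rw [← h]
  refine measure_congr ?_
  filter_upwards [gevNu_ae] with s hs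
  exact propext ⟨fun _ => hs.le, fun _ => trivial⟩

instance : IsProbabilityMeasure gevNu := ⟨gevNu_univ⟩

lemma gev_mem_exp (t : ℝ) (ht : -1 < t) : Integrable (fun s => Real.exp (t * Real.log s)) gevNu ∧
    ∫ s, Real.exp (t * Real.log s) ∂gevNu = Real.Gamma (t + 1) := by
  have e : Set.EqOn (fun s => Real.exp (-s) * s ^ (t + 1 - 1))
      (fun s => Real.exp (-s) * Real.exp (t * Real.log s)) (Set.Ioi (0:ℝ)) := by
    intro s hs
    simp only [add_sub_cancel_right]
    rw [Real.rpow_def_of_pos hs, mul_comm t]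
  rw [gevNu_integrable, gevNu_integral, Real.Gamma_eq_integral (by linarith)]
  exact ⟨(Real.GammaIntegral_convergent (by linarith)).congr_fun e measurableSet_Ioi,
    (setIntegral_congr_fun measurableSet_Ioi e).symm⟩

lemma gev_mem_interior (t : ℝ) (ht : -1 < t) :
    t ∈ interior (ProbabilityTheory.integrableExpSet Real.log gevNu) := by
  rw [mem_interior]
  exact ⟨Set.Ioi (-1), fun x hx => (gev_mem_exp x hx).1, isOpen_Ioi, ht⟩

lemma gev_gamma_deriv (t : ℝ) (ht : -1 < t) (b : ℕ) :
    iteratedDeriv b Real.Gamma (t + 1) = ∫ s, Real.log s ^ b * Real.exp (t * Real.log s) ∂gevNu := by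
  rw [← ProbabilityTheory.iteratedDeriv_mgf (gev_mem_interior t ht) b]
  have h : ProbabilityTheory.mgf Real.log gevNu =ᶠ[nhds t] fun t => Real.Gamma (t + 1) := by
    filter_upwards [isOpen_Ioi.mem_nhds (show t ∈ Set.Ioi (-1:ℝ) from ht)] with x hx
    exact (gev_mem_exp x hx).2
  rw [h.iteratedDeriv_eq b, iteratedDeriv_comp_add_const]

lemma gev_log_int (t : ℝ) (ht : -1 < t) (b : ℕ) :
    IntegrableOn (fun s => |Real.log s| ^ b * Real.exp (t * Real.log s)) (Set.Ioo (0:ℝ) 1) ∧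
    ∫ s in Set.Ioo (0:ℝ) 1, |Real.log s| ^ b * Real.exp (t * Real.log s)
      = Real.Gamma (b + 1) / (t + 1) ^ (b + 1) := by
  have him : (fun x : ℝ => Real.exp (-x)) '' Set.Ioi 0 = Set.Ioo 0 1 := by
    ext s
    constructor
    · rintro ⟨x, hx, rfl⟩
      exact ⟨Real.exp_pos _, by simpa using hx⟩
    · rintro ⟨h0, h1⟩
      exact ⟨-Real.log s, by simpa using Real.log_neg h0 h1, by simp [Real.exp_log h0]⟩
  have hd : ∀ x ∈ Set.Ioi (0:ℝ), HasDerivWithinAt (fun x : ℝ => Real.exp (-x))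
      (-Real.exp (-x)) (Set.Ioi 0) x := by
    intro x _
    simpa using ((hasDerivAt_neg x).exp).hasDerivWithinAt
  have hinj : Set.InjOn (fun x : ℝ => Real.exp (-x)) (Set.Ioi 0) := by
    intro x _ y _ h
    simpa using h
  have e : Set.EqOn (fun x : ℝ => x ^ ((b + 1 : ℝ) - 1) * Real.exp (-((t + 1) * x)))
      (fun x => |-Real.exp (-x)| • (|Real.log (Real.exp (-x))| ^ b *
        Real.exp (t * Real.log (Real.exp (-x))))) (Set.Ioi 0) := by
    intro x hx
    have hx' : (0:ℝ) < x := hx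
    simp only [add_sub_cancel_right, Real.log_exp, abs_neg, Real.abs_exp, smul_eq_mul,
      abs_of_pos hx', Real.rpow_natCast]
    rw [mul_left_comm, ← Real.exp_add]
    ring_nf
  have hI : IntegrableOn (fun x : ℝ => x ^ ((b + 1 : ℝ) - 1) * Real.exp (-((t + 1) * x)))
      (Set.Ioi 0) := by
    have := integrableOn_rpow_mul_exp_neg_mul_rpow (p := 1) (s := (b:ℝ)+1-1) (b := t + 1)
      (by have : (0:ℝ) ≤ b := b.cast_nonneg
          linarith) one_pos (by linarith)
    refine this.congr_fun (fun x _ => ?_) measurableSet_Ioi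
    simp only [Real.rpow_one, neg_mul]
  rw [← him, integrableOn_image_iff_integrableOn_abs_deriv_smul measurableSet_Ioi hd hinj,
    integral_image_eq_integral_abs_deriv_smul measurableSet_Ioi hd hinj]
  refine ⟨hI.congr_fun e measurableSet_Ioi, ?_⟩
  rw [← setIntegral_congr_fun measurableSet_Ioi e,
    Real.integral_rpow_mul_exp_neg_mul_Ioi (by positivity) (by linarith)]
  have : (0:ℝ) < t + 1 := by linarith
  rw [show ((b:ℝ) + 1) = ((b + 1 : ℕ) : ℝ) by push_cast; ring, Real.rpow_natCast, one_div,
    inv_pow, mul_comm, div_eq_mul_inv]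

lemma gev_bound (t : ℝ) (ht : -1 < t) (b : ℕ) :
    ∫ s, |Real.log s| ^ b * Real.exp (t * Real.log s) ∂gevNu <
      iteratedDeriv b Real.Gamma (t + 1) + 3 * (Real.Gamma (b + 1) / (t + 1) ^ (b + 1)) := by
  have hm := gev_mem_interior t ht
  have h1 := ProbabilityTheory.integrable_pow_abs_mul_exp_of_mem_interior_integrableExpSet hm b
  have h2 := ProbabilityTheory.integrable_pow_mul_exp_of_mem_interior_integrableExpSet hm b
  obtain ⟨h3, h4⟩ := gev_log_int t ht b
  have hpos : 0 < Real.Gamma (b + 1) / (t + 1) ^ (b + 1) := by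
    have : (0:ℝ) < t + 1 := by linarith
    have := Real.Gamma_pos_of_pos (show (0:ℝ) < b + 1 by positivity)
    positivity
  have key : ∫ s, |Real.log s| ^ b * Real.exp (t * Real.log s) ∂gevNu
      - ∫ s, Real.log s ^ b * Real.exp (t * Real.log s) ∂gevNu ≤
      2 * (Real.Gamma (b + 1) / (t + 1) ^ (b + 1)) := by
    rw [← integral_sub h1 h2, gevNu_integral, ← h4, ← integral_const_mul]
    have hsub : Set.Ioo (0:ℝ) 1 ⊆ Set.Ioi 0 := fun x hx => hx.1
    have hr : ∫ s in Set.Ioo (0:ℝ) 1, 2 * (|Real.log s| ^ b * Real.exp (t * Real.log s)) =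
        ∫ s in Set.Ioi (0:ℝ), (Set.Ioo (0:ℝ) 1).indicator
          (fun s => 2 * (|Real.log s| ^ b * Real.exp (t * Real.log s))) s := by
      rw [setIntegral_indicator measurableSet_Ioo, Set.inter_eq_right.2 hsub]
    rw [hr]
    refine setIntegral_mono_on ((gevNu_integrable _).1 (h1.sub h2)) ?_ measurableSet_Ioi ?_
    · exact ((integrable_indicator_iff measurableSet_Ioo).2 (h3.const_mul 2)).integrableOn
    · intro s hs
      have hs' : (0:ℝ) < s := hs
      by_cases h : s < 1
      · rw [Set.indicator_of_mem (show s ∈ Set.Ioo (0:ℝ) 1 from ⟨hs, h⟩)]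
        have a1 : -(|Real.log s| ^ b) ≤ Real.log s ^ b := by
          rw [← abs_pow]; exact neg_abs_le _
        have a2 : Real.exp (-s) ≤ 1 := Real.exp_le_one_iff.2 (by linarith)
        have a3 := Real.exp_pos (t * Real.log s)
        have a4 : 0 ≤ |Real.log s| ^ b := by positivity
        calc _ ≤ Real.exp (-s) * (2 * (|Real.log s| ^ b * Real.exp (t * Real.log s))) := by
              refine mul_le_mul_of_nonneg_left ?_ (Real.exp_pos _).le
              nlinarith
          _ ≤ _ := mul_le_of_le_one_left (by positivity) a2
      · rw [Set.indicator_of_notMem (fun h' => h h'.2), abs_of_nonneg (Real.log_nonneg (not_lt.1 h))]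
        simp
  rw [gev_gamma_deriv t ht b]
  linarith

lemma gev_map {Ω : Type*} [MeasurableSpace Ω] (P : Measure Ω)
    [IsProbabilityMeasure P] (τ₀ μ₀ ξ₀ : ℝ) (hτ : 0 < τ₀) (hξ : ξ₀ ≠ 0)
    (Y : Ω → ℝ) (hY : Measurable Y)
    (hcdf : ∀ y : ℝ, (P {ω | Y ω ≤ y}).toReal = gevCDF τ₀ μ₀ ξ₀ y) :
    P.map Y = gevNu.map (fun s => μ₀ + τ₀ * (s ^ (-ξ₀) - 1) / ξ₀) := by
  have hf : Measurable (fun s : ℝ => μ₀ + τ₀ * (s ^ (-ξ₀) - 1) / ξ₀) := by fun_prop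
  have := Measure.isProbabilityMeasure_map (μ := P) hY.aemeasurable
  refine Measure.ext_of_Iic _ _ fun y => ?_
  rw [Measure.map_apply hY measurableSet_Iic, Measure.map_apply hf measurableSet_Iic]
  have hl : P (Y ⁻¹' Set.Iic y) = ENNReal.ofReal (gevCDF τ₀ μ₀ ξ₀ y) := by
    rw [← hcdf y, ENNReal.ofReal_toReal (measure_ne_top _ _)]; rfl
  rw [hl]
  unfold gevCDF
  set w := 1 + ξ₀ * (y - μ₀) / τ₀ with hw
  have hyw : y = μ₀ + τ₀ * (w - 1) / ξ₀ := by rw [hw]; field_simp; ring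
  rcases lt_or_gt_of_ne hξ with hneg | hpos
  · have hiff : ∀ s : ℝ, μ₀ + τ₀ * (s ^ (-ξ₀) - 1) / ξ₀ ≤ y ↔ w ≤ s ^ (-ξ₀) := by
      intro s
      rw [hyw, add_le_add_iff_left, div_le_div_right_of_neg hneg, mul_le_mul_iff_right₀ hτ,
        sub_le_sub_iff_right]
    split_ifs with h1 h2
    · rw [← gevNu_Ici _ (Real.rpow_nonneg h1.le _)]
      refine measure_congr ?_
      filter_upwards [gevNu_ae] with s hs
      refine propext (Iff.trans ?_ (hiff s).symm)
      change w ^ (-1 / ξ₀) ≤ s ↔ _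
      rw [show -1 / ξ₀ = (-ξ₀)⁻¹ by rw [inv_neg]; field_simp]
      exact Real.rpow_inv_le_iff_of_pos h1.le hs.le (by linarith)
    · linarith
    · rw [ENNReal.ofReal_one, ← gevNu_univ]
      refine measure_congr ?_
      filter_upwards [gevNu_ae] with s hs
      refine propext ⟨fun _ => (hiff s).2 ?_, fun _ => trivial⟩
      exact (not_lt.1 h1).trans (Real.rpow_nonneg hs.le _)
  · have hiff : ∀ s : ℝ, μ₀ + τ₀ * (s ^ (-ξ₀) - 1) / ξ₀ ≤ y ↔ s ^ (-ξ₀) ≤ w := by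
      intro s
      rw [hyw, add_le_add_iff_left, div_le_div_iff_of_pos_right hpos, mul_le_mul_iff_right₀ hτ,
        sub_le_sub_iff_right]
    split_ifs with h1
    · rw [← gevNu_Ici _ (Real.rpow_nonneg h1.le _)]
      refine measure_congr ?_
      filter_upwards [gevNu_ae] with s hs
      refine propext (Iff.trans ?_ (hiff s).symm)
      change w ^ (-1 / ξ₀) ≤ s ↔ _
      rw [show -1 / ξ₀ = (-ξ₀)⁻¹ by rw [inv_neg]; field_simp]
      exact Real.rpow_inv_le_iff_of_neg h1 hs (by linarith)
    · rw [ENNReal.ofReal_zero, ← measure_empty (μ := gevNu)]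
      refine measure_congr ?_
      filter_upwards [gevNu_ae] with s hs
      refine propext ⟨fun h => h.elim, fun h => ?_⟩
      exact h1 ((Real.rpow_pos_of_pos hs _).trans_le ((hiff s).1 h))

theorem gev_abs_log_moment_bound {Ω : Type*} [MeasurableSpace Ω] (P : Measure Ω)
    [IsProbabilityMeasure P] (τ₀ μ₀ ξ₀ : ℝ) (hτ : 0 < τ₀) (hξ : ξ₀ ≠ 0)
    (Y : Ω → ℝ) (hY : Measurable Y)
    (hcdf : ∀ y : ℝ, (P {ω | Y ω ≤ y}).toReal = gevCDF τ₀ μ₀ ξ₀ y)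
    (α : ℝ) (hα : 0 < α * ξ₀ + 1) (b : ℕ) (hb : 0 < b) :
    ∫ ω, (1 + ξ₀ * (Y ω - μ₀) / τ₀) ^ (-α) *
        |Real.log (1 + ξ₀ * (Y ω - μ₀) / τ₀)| ^ b ∂P <
      |ξ₀| ^ b * iteratedDeriv b Real.Gamma (α * ξ₀ + 1) +
        3 * |ξ₀| ^ b / (α * ξ₀ + 1) ^ (b + 1) * Real.Gamma (b + 1) := by
  have hg : Measurable (fun y : ℝ => (1 + ξ₀ * (y - μ₀) / τ₀) ^ (-α) *
        |Real.log (1 + ξ₀ * (y - μ₀) / τ₀)| ^ b) := by fun_prop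
  have hf : Measurable (fun s : ℝ => μ₀ + τ₀ * (s ^ (-ξ₀) - 1) / ξ₀) := by fun_prop
  have h1 := integral_map (μ := P) hY.aemeasurable hg.aestronglyMeasurable
  rw [← h1, gev_map P τ₀ μ₀ ξ₀ hτ hξ Y hY hcdf,
    integral_map hf.aemeasurable hg.aestronglyMeasurable]
  have h2 : ∫ s, (1 + ξ₀ * ((μ₀ + τ₀ * (s ^ (-ξ₀) - 1) / ξ₀) - μ₀) / τ₀) ^ (-α) *
        |Real.log (1 + ξ₀ * ((μ₀ + τ₀ * (s ^ (-ξ₀) - 1) / ξ₀) - μ₀) / τ₀)| ^ b ∂gevNu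
      = ∫ s, |ξ₀| ^ b * (|Real.log s| ^ b * Real.exp (α * ξ₀ * Real.log s)) ∂gevNu := by
    refine integral_congr_ae ?_
    filter_upwards [gevNu_ae] with s hs
    have : 1 + ξ₀ * ((μ₀ + τ₀ * (s ^ (-ξ₀) - 1) / ξ₀) - μ₀) / τ₀ = s ^ (-ξ₀) := by
      field_simp; ring
    rw [this, Real.log_rpow hs, abs_mul, abs_neg, mul_pow, ← Real.rpow_mul hs.le,
      Real.rpow_def_of_pos hs]
    ring_nf
  rw [h2, integral_const_mul]
  have h3 := gev_bound (α * ξ₀) (by linarith) b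
  have h4 : 0 < |ξ₀| ^ b := by positivity
  have h5 := mul_lt_mul_of_pos_left h3 h4
  refine h5.trans_eq ?_
  ring
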